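/- Let M = (Q, Σ, δ, q₀, F) be an NFA in which every state is accessible and co-accessible. If for every state q ∈ Q the language L_q is commutative, then L(M) has polynomial growth. -/

import Mathlib

open Computability

/-- The number of words of length `m` in the language `L`. -/
noncomputable def Language.growthCount {α : Type*} (L : Language α) (m : ℕ) : ℕ :=
  {w ∈ (L : Set (List α)) | w.length = m}.ncard

/-- `L` has polynomial growth: there is a polynomial `p` with `|L ∩ Σ^m| ≤ p(m)` for all `m`. -/
def Language.HasPolynomialGrowth {α : Type*} (L : Language α) : Prop :=
  ∃ p : Polynomial ℕ, ∀ m : ℕ, L.growthCount m ≤ p.eval m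

/-- `L` is commutative: `L ⊆ u*` for some word `u`. -/
def Language.IsCommutativeLang {α : Type*} (L : Language α) : Prop :=
  ∃ u : List α, L ≤ ({u} : Language α)∗

/-- The state `q` of the NFA `M` is accessible: it is reachable from the start by some word. -/
def NFA.Accessible {α σ : Type*} (M : NFA α σ) (q : σ) : Prop :=
  ∃ w : List α, q ∈ M.eval w

/-- The state `q` is co-accessible: some accepting state is reachable from `q` by some word. -/
def NFA.CoAccessible {α σ : Type*} (M : NFA α σ) (q : σ) : Prop :=
  ∃ w : List α, (M.evalFrom {q} w ∩ M.accept).Nonempty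

/-- `L_q`: the language of words that can take `M` from state `q` back to state `q`. -/
def NFA.loopLang {α σ : Type*} (M : NFA α σ) (q : σ) : Language α :=
  {w | q ∈ M.evalFrom {q} w}

theorem Polynomial.eval_monotone_nat (p : Polynomial ℕ) : Monotone fun m : ℕ => p.eval m := by
  intro a b hab
  simp only [Polynomial.eval_eq_sum_range]
  gcongr

namespace Language

variable {α : Type*}

theorem finite_setOf_mem_length_eq [Finite α] (L : Language α) (m : ℕ) :
    {w ∈ (L : Set (List α)) | w.length = m}.Finite :=
  (List.finite_length_eq α m).subset fun _ hw => hw.2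

theorem growthCount_mono [Finite α] {L K : Language α} (h : L ≤ K) (m : ℕ) :
    L.growthCount m ≤ K.growthCount m :=
  Set.ncard_le_ncard (fun _ hw => ⟨h hw.1, hw.2⟩) (K.finite_setOf_mem_length_eq m)

theorem HasPolynomialGrowth.mono [Finite α] {L K : Language α} (hK : K.HasPolynomialGrowth)
    (h : L ≤ K) : L.HasPolynomialGrowth :=
  let ⟨p, hp⟩ := hK
  ⟨p, fun m => (growthCount_mono h m).trans (hp m)⟩

theorem hasPolynomialGrowth_of_finite {L : Language α} (h : (L : Set (List α)).Finite) :
    L.HasPolynomialGrowth := by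
  refine ⟨Polynomial.C (L : Set (List α)).ncard, fun m => ?_⟩
  rw [Polynomial.eval_C]
  exact Set.ncard_le_ncard (fun _ hw => hw.1) h

theorem growthCount_mul_le [Finite α] (L K : Language α) (m : ℕ) :
    (L * K).growthCount m ≤
      ∑ ij ∈ Finset.HasAntidiagonal.antidiagonal m, L.growthCount ij.1 * K.growthCount ij.2 := by
  classical
  have hsub : {w ∈ ((L * K : Language α) : Set (List α)) | w.length = m} ⊆
      ⋃ ij ∈ Finset.HasAntidiagonal.antidiagonal m, (fun x : List α × List α => x.1 ++ x.2) ''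
        ({w ∈ (L : Set (List α)) | w.length = ij.1} ×ˢ
          {w ∈ (K : Set (List α)) | w.length = ij.2}) := by
    rintro w ⟨hw, hm⟩
    obtain ⟨x, hx, y, hy, rfl⟩ := Language.mem_mul.1 hw
    simp only [Set.mem_iUnion]
    exact ⟨(x.length, y.length), by simpa using hm, (x, y), ⟨⟨hx, rfl⟩, hy, rfl⟩, rfl⟩
  have hfin (ij : ℕ × ℕ) := (L.finite_setOf_mem_length_eq ij.1).prod
    (K.finite_setOf_mem_length_eq ij.2)
  refine (Set.ncard_le_ncard hsub
    ((Finset.finite_toSet _).biUnion fun ij _ => (hfin ij).image _)).trans ?_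
  refine (Finset.set_ncard_biUnion_le _ _).trans (Finset.sum_le_sum fun ij _ => ?_)
  exact (Set.ncard_image_le (hfin ij)).trans_eq Set.ncard_prod

theorem HasPolynomialGrowth.mul [Finite α] {L K : Language α} (hL : L.HasPolynomialGrowth)
    (hK : K.HasPolynomialGrowth) : (L * K).HasPolynomialGrowth := by
  obtain ⟨p, hp⟩ := hL
  obtain ⟨q, hq⟩ := hK
  refine ⟨(Polynomial.X + 1) * (p * q), fun m => (growthCount_mul_le L K m).trans ?_⟩
  have hterm : ∀ ij ∈ Finset.HasAntidiagonal.antidiagonal m,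
      L.growthCount ij.1 * K.growthCount ij.2 ≤ p.eval m * q.eval m := fun ij hij =>
    Nat.mul_le_mul
      ((hp _).trans (p.eval_monotone_nat (Nat.le.intro (Finset.HasAntidiagonal.mem_antidiagonal.1 hij))))
      ((hq _).trans (q.eval_monotone_nat (Nat.le.intro
        ((Nat.add_comm _ _).trans (Finset.HasAntidiagonal.mem_antidiagonal.1 hij)))))
  simpa using Finset.sum_le_card_nsmul _ _ _ hterm

theorem HasPolynomialGrowth.pow [Finite α] {L : Language α} (hL : L.HasPolynomialGrowth) (n : ℕ) :
    (L ^ n).HasPolynomialGrowth := by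
  induction n with
  | zero =>
    rw [pow_zero]
    exact hasPolynomialGrowth_of_finite (Set.finite_singleton [])
  | succ n ih =>
    rw [pow_succ]
    exact ih.mul hL

theorem hasPolynomialGrowth_iSup [Finite α] {ι : Type*} [Fintype ι] {L : ι → Language α}
    (hL : ∀ i, (L i).HasPolynomialGrowth) : (⨆ i, L i).HasPolynomialGrowth := by
  choose p hp using hL
  refine ⟨∑ i, p i, fun m => ?_⟩
  rw [Polynomial.eval_finsetSum]
  have hsub : {w ∈ ((⨆ i, L i : Language α) : Set (List α)) | w.length = m} ⊆
      ⋃ i ∈ (Finset.univ : Finset ι), {w ∈ (L i : Set (List α)) | w.length = m} := by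
    rintro w ⟨hw, hm⟩
    obtain ⟨i, hi⟩ := Language.mem_iSup.1 hw
    simp only [Set.mem_iUnion]
    exact ⟨i, Finset.mem_univ i, hi, hm⟩
  refine (Set.ncard_le_ncard hsub ((Finset.finite_toSet _).biUnion fun i _ =>
    (L i).finite_setOf_mem_length_eq m)).trans ?_
  exact (Finset.set_ncard_biUnion_le _ _).trans (Finset.sum_le_sum fun i _ => hp i m)

theorem IsCommutativeLang.eq_of_length_eq {L : Language α} (hL : L.IsCommutativeLang)
    {x y : List α} (hx : x ∈ L) (hy : y ∈ L) (h : x.length = y.length) : x = y := by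
  obtain ⟨u, hu⟩ := hL
  have key : ∀ w ∈ L, ∃ k, w = (List.replicate k u).flatten := fun w hw => by
    obtain ⟨S, rfl, hS⟩ := Language.mem_kstar.1 (hu hw)
    exact ⟨S.length, congrArg _ (List.eq_replicate_iff.2 ⟨rfl, hS⟩)⟩
  obtain ⟨k, rfl⟩ := key x hx
  obtain ⟨l, rfl⟩ := key y hy
  rcases eq_or_ne u [] with rfl | hne
  · simp
  · have hpos : u.length ≠ 0 := by simpa using hne
    have hkl : k = l := by simpa [hpos] using h
    rw [hkl]

theorem IsCommutativeLang.hasPolynomialGrowth {L : Language α} (hL : L.IsCommutativeLang) :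
    L.HasPolynomialGrowth := by
  refine ⟨1, fun m => ?_⟩
  rw [Polynomial.eval_one]
  have hsub : {w ∈ (L : Set (List α)) | w.length = m}.Subsingleton := fun x hx y hy =>
    hL.eq_of_length_eq hx.1 hy.1 (hx.2.trans hy.2.symm)
  exact (Set.ncard_le_one hsub.finite).2 fun x hx y hy => hsub hx hy

/-- The language of words of length at most one. -/
def atMostOneLetter (α : Type*) : Language α :=
  {w | w.length ≤ 1}

theorem hasPolynomialGrowth_atMostOneLetter [Finite α] :
    (atMostOneLetter α).HasPolynomialGrowth :=
  hasPolynomialGrowth_of_finite (List.finite_length_le α 1)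

theorem nil_mem_pow {L : Language α} (h : [] ∈ L) (n : ℕ) : [] ∈ L ^ n := by
  induction n with
  | zero => exact Language.nil_mem_one
  | succ n ih =>
    rw [pow_succ]
    exact Language.mem_mul.2 ⟨[], ih, [], h, rfl⟩

end Language

namespace NFA

variable {α σ : Type*} {M : NFA α σ}

/-- A path visiting `q` splits at its last visit to `q`. -/
theorem Path.exists_split_last_visit [DecidableEq σ] {s t : σ} {x : List α} (p : M.Path s t x)
    {q : σ} (hq : q ∈ p.supp) :
    ∃ y z, x = y ++ z ∧ Nonempty (M.Path s q y) ∧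
      (z = [] ∨ ∃ a z' r, z = a :: z' ∧ ∃ p' : M.Path r t z', p'.supp ⊆ p.supp.erase q) := by
  induction p with
  | nil s =>
    obtain rfl : q = s := by simpa using hq
    exact ⟨[], [], rfl, ⟨.nil _⟩, .inl rfl⟩
  | cons r s t a x hstep p ih =>
    by_cases hqp : q ∈ p.supp
    · obtain ⟨y, z, rfl, ⟨py⟩, hz⟩ := ih hqp
      refine ⟨a :: y, z, rfl, ⟨.cons _ _ _ _ _ hstep py⟩, hz.imp_right ?_⟩
      rintro ⟨b, z', r', rfl, p', hp'⟩
      exact ⟨b, z', r', rfl, p', hp'.trans (Finset.erase_subset_erase _ (by simp))⟩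
    · obtain rfl : q = s := by simpa [hqp] using hq
      refine ⟨[], a :: x, rfl, ⟨.nil _⟩, .inr ⟨a, x, r, rfl, p, ?_⟩⟩
      exact Finset.subset_erase.2 ⟨by simp, hqp⟩

theorem Path.start_mem_supp [DecidableEq σ] {s t : σ} {x : List α} (p : M.Path s t x) :
    s ∈ p.supp := by
  cases p <;> simp

theorem nil_mem_loopLang (q : σ) : [] ∈ M.loopLang q :=
  Set.mem_singleton q

/-- A path visiting at most `n` states is labelled by a product of `n` words, each of which is a
loop followed by at most one letter. -/
theorem Path.mem_pow_loopLang [DecidableEq σ] (n : ℕ) {s t : σ} {x : List α} (p : M.Path s t x)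
    (hn : p.supp.card ≤ n) :
    x ∈ ((⨆ q, M.loopLang q) * Language.atMostOneLetter α) ^ n := by
  induction n generalizing s t x with
  | zero =>
    have := Finset.card_pos.2 ⟨s, p.start_mem_supp⟩
    omega
  | succ n ih =>
    rw [pow_succ']
    obtain ⟨y, z, rfl, hy, hz⟩ := p.exists_split_last_visit p.start_mem_supp
    have hyU : y ∈ ⨆ q, M.loopLang q :=
      Language.mem_iSup.2 ⟨s, mem_evalFrom_iff_nonempty_path.2 hy⟩
    rcases hz with rfl | ⟨a, z', r, rfl, p', hp'⟩
    · refine Language.append_mem_mul (Language.mem_mul.2 ⟨y, hyU, [], Nat.zero_le 1, by simp⟩)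
        (Language.nil_mem_pow (Language.mem_mul.2 ⟨[], ?_, [], Nat.zero_le 1, rfl⟩) n)
      exact Language.mem_iSup.2 ⟨s, nil_mem_loopLang s⟩
    · refine Language.mem_mul.2 ⟨y ++ [a],
        Language.mem_mul.2 ⟨y, hyU, [a], le_refl 1, rfl⟩, z', ih p' ?_, by simp⟩
      have h1 := Finset.card_le_card hp'
      rw [Finset.card_erase_of_mem p.start_mem_supp] at h1
      omega

end NFA

/-- If every state of the NFA `M` (with start state `q₀`) is accessible and co-accessible
and every language `L_q` is commutative, then `L(M)` has polynomial growth. -/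
theorem hasPolynomialGrowth_of_loopLang_isCommutative {α σ : Type*} [Fintype α] [Fintype σ]
    (M : NFA α σ) (q₀ : σ) (hstart : M.start = {q₀})
    (hacc : ∀ q : σ, M.Accessible q) (hcoacc : ∀ q : σ, M.CoAccessible q)
    (hcomm : ∀ q : σ, (M.loopLang q).IsCommutativeLang) :
    M.accepts.HasPolynomialGrowth := by
  classical
  have hloops := Language.hasPolynomialGrowth_iSup fun q => (hcomm q).hasPolynomialGrowth
  refine ((hloops.mul Language.hasPolynomialGrowth_atMostOneLetter).pow (Fintype.card σ)).mono
    fun x hx => ?_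
  obtain ⟨s, -, t, -, ⟨p⟩⟩ := NFA.accepts_iff_exists_path.1 hx
  exact p.mem_pow_loopLang _ (Finset.card_le_univ _)
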